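/- arXiv:2212.13787 — 6 statements merged into one kernel-verified Lean document; each statement's English description precedes it below -/
import Mathlib

section
/- For all natural numbers n ≥ 2 and k ≥ 1, (n−1) · (C(n+k−1, k)² − C(n+k−2, k−1)²) = (n+2k−1) · C(n+k−2, k)², where C(a,b) denotes the binomial coefficient. (This is the paper's formula for the dimension of the complement of hom(S^{k−1}V) inside hom(S^k V) when dim V = n, which equals the dimension of the Cartan power g^{(k)} of su(n).) -/
/-- For all natural numbers `n ≥ 2` and `k ≥ 1`,
`(n−1) · (C(n+k−1, k)² − C(n+k−2, k−1)²) = (n+2k−1) · C(n+k−2, k)²`. -/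
theorem stmt_0 (n k : ℕ) (hn : 2 ≤ n) (hk : 1 ≤ k) :
    (n - 1) * ((n + k - 1).choose k ^ 2 - (n + k - 2).choose (k - 1) ^ 2) =
      (n + 2 * k - 1) * (n + k - 2).choose k ^ 2 := by
  obtain ⟨m, rfl⟩ := Nat.exists_eq_add_of_le' hn
  obtain ⟨j, rfl⟩ := Nat.exists_eq_add_of_le' hk
  have absorb := Nat.choose_succ_right_eq (m + j + 1) j
  rw [show m + j + 1 - j = m + 1 by lia] at absorb
  rw [show m + 2 - 1 = m + 1 by lia, show m + 2 + (j + 1) - 1 = m + j + 1 + 1 by lia,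
    show m + 2 + (j + 1) - 2 = m + j + 1 by lia, show j + 1 - 1 = j by lia,
    show m + 2 + 2 * (j + 1) - 1 = m + 2 * j + 3 by lia, Nat.choose_succ_succ']
  generalize (m + j + 1).choose j = a at *
  generalize (m + j + 1).choose (j + 1) = b at *
  rw [show (a + b) ^ 2 - a ^ 2 = (2 * a + b) * b from Nat.sub_eq_of_eq_add (by ring)]
  calc
    (m + 1) * ((2 * a + b) * b) = 2 * b * (a * (m + 1)) + (m + 1) * b ^ 2 := by ring
    _ = (m + 2 * j + 3) * b ^ 2 := by rw [← absorb]; ring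
end

section
/- Let n ≥ 1 and p, q be integers with 0 ≤ p ≤ q ≤ n. Define λ ∈ ℚⁿ by λ_i = 1 for 1 ≤ i ≤ p, λ_i = 0 for p < i ≤ q, and λ_i = −1 for q < i ≤ n. Then ∏_{1≤i<j≤n} (λ_i − λ_j + j − i)/(j − i) = ((q−p+1) · C(n+1, p) · C(n+1, n−q)) / (n+1) in ℚ. (This is the paper's closed form Ψ₁ for the Weyl dimension of the SU(n)-irreducible with highest weight (1^p, 0^{q−p}, (−1)^{n−q}); for p = k, q = n−k it gives dim g^{(1^k)} = ((n−2k+1)/(n+1))·C(n+1,k)².) -/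
theorem prod_Ioc_mul_prod_Ioc {M : Type*} [CommMonoid M] (f : ℕ → M) {a b c : ℕ}
    (hab : a ≤ b) (hbc : b ≤ c) :
    (∏ i ∈ Finset.Ioc a b, f i) * ∏ i ∈ Finset.Ioc b c, f i = ∏ i ∈ Finset.Ioc a c, f i := by
  rw [← Finset.Ioc_union_Ioc_eq_Ioc hab hbc,
    Finset.prod_union (Finset.Ioc_disjoint_Ioc_of_le le_rfl)]

theorem prod_Ioc_shift_one_div {i a b : ℕ} (hia : i ≤ a) (hab : a ≤ b) :
    ∏ j ∈ Finset.Ioc a b, (1 + (j : ℚ) - i) / ((j : ℚ) - i) =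
      ((b : ℚ) - i + 1) / ((a : ℚ) - i + 1) := by
  have hi : (i : ℚ) ≤ a := by exact_mod_cast hia
  induction b, hab using Nat.le_induction with
  | base =>
    have h : (a : ℚ) - i + 1 ≠ 0 := by linarith
    simp [div_self h]
  | succ b hab ih =>
    have hb : (a : ℚ) ≤ b := by exact_mod_cast hab
    have h : (a : ℚ) - i + 1 ≠ 0 := by linarith
    have h' : (b : ℚ) - i + 1 ≠ 0 := by linarith
    have h'' : (b : ℚ) + 1 - i ≠ 0 := by linarith
    rw [Finset.prod_Ioc_succ_top hab, ih]
    push_cast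
    field_simp
    ring

theorem prod_Ioc_shift_two_div {i a b : ℕ} (hia : i ≤ a) (hab : a ≤ b) :
    ∏ j ∈ Finset.Ioc a b, (2 + (j : ℚ) - i) / ((j : ℚ) - i) =
      ((b : ℚ) - i + 1) * ((b : ℚ) - i + 2) / (((a : ℚ) - i + 1) * ((a : ℚ) - i + 2)) := by
  have hi : (i : ℚ) ≤ a := by exact_mod_cast hia
  have h : (a : ℚ) - i + 1 ≠ 0 := by linarith
  have h2 : (a : ℚ) - i + 2 ≠ 0 := by linarith
  induction b, hab using Nat.le_induction with
  | base => simp [div_self (mul_ne_zero h h2)]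
  | succ b hab ih =>
    have hb : (a : ℚ) ≤ b := by exact_mod_cast hab
    have h'' : (b : ℚ) + 1 - i ≠ 0 := by linarith
    rw [Finset.prod_Ioc_succ_top hab, ih]
    push_cast
    field_simp
    ring

theorem prod_Ioc_sub_add_one {a s t : ℕ} (hst : s ≤ t) (hta : t ≤ a) :
    ∏ i ∈ Finset.Ioc s t, ((a : ℚ) - i + 1) = ((a - s).factorial : ℚ) / (a - t).factorial := by
  induction t, hst using Nat.le_induction with
  | base => simp [div_self, Nat.factorial_ne_zero]
  | succ t hst ih =>
    rw [Finset.prod_Ioc_succ_top hst, ih (by omega)]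
    obtain ⟨d, rfl⟩ := Nat.exists_eq_add_of_le hta
    have e : t + 1 + d - t = d + 1 := by omega
    have h : ((d.factorial : ℕ) : ℚ) ≠ 0 := by exact_mod_cast d.factorial_ne_zero
    rw [e, Nat.add_sub_cancel_left, Nat.factorial_succ]
    push_cast
    field_simp
    ring

/-- For `n ≥ 1` and `0 ≤ p ≤ q ≤ n`, with `λ_i = 1` for `1 ≤ i ≤ p`, `λ_i = 0` for
`p < i ≤ q`, and `λ_i = −1` for `q < i ≤ n`, Weyl's dimension formula gives
`∏_{1≤i<j≤n} (λ_i − λ_j + j − i)/(j − i) = ((q−p+1)·C(n+1,p)·C(n+1,n−q))/(n+1)`. -/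
theorem stmt_12 (n p q : ℕ) (hn : 1 ≤ n) (hpq : p ≤ q) (hqn : q ≤ n) (lam : ℕ → ℚ)
    (hlam : ∀ i, lam i = if i ≤ p then (1 : ℚ) else if i ≤ q then 0 else -1) :
    ∏ i ∈ Finset.Icc 1 n, ∏ j ∈ Finset.Icc (i + 1) n,
        (lam i - lam j + (j : ℚ) - i) / ((j : ℚ) - i) =
      ((q : ℚ) - p + 1) * ((n + 1).choose p) * ((n + 1).choose (n - q)) / ((n : ℚ) + 1) := by
  have inner_eq_one : ∀ i a b : ℕ, i ≤ a →
      (∀ j ∈ Finset.Ioc a b, lam i = lam j) →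
      ∏ j ∈ Finset.Ioc a b, (lam i - lam j + (j : ℚ) - i) / ((j : ℚ) - i) = 1 := by
    intro i a b hia h
    refine Finset.prod_eq_one fun j hj => ?_
    have hij : (i : ℚ) < j := by
      exact_mod_cast lt_of_le_of_lt hia (Finset.mem_Ioc.1 hj).1
    rw [h j hj, sub_self, zero_add, div_self (by linarith)]
  have inner_low : ∀ i ∈ Finset.Ioc 0 p,
      ∏ j ∈ Finset.Ioc i n, (lam i - lam j + (j : ℚ) - i) / ((j : ℚ) - i) =
        (((n + 1 : ℕ) : ℚ) - i + 1) * ((n : ℚ) - i + 1) /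
          (((p : ℚ) - i + 1) * (((q + 1 : ℕ) : ℚ) - i + 1)) := by
    intro i hi
    have hip := (Finset.mem_Ioc.1 hi).2
    rw [← prod_Ioc_mul_prod_Ioc _ (hip.trans hpq) hqn, ← prod_Ioc_mul_prod_Ioc _ hip hpq,
      inner_eq_one i i p le_rfl (by
        intro j hj
        rw [hlam, hlam, if_pos hip, if_pos (Finset.mem_Ioc.1 hj).2]), one_mul]
    have h1 : ∏ j ∈ Finset.Ioc p q, (lam i - lam j + (j : ℚ) - i) / ((j : ℚ) - i) =
        ((q : ℚ) - i + 1) / ((p : ℚ) - i + 1) := by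
      rw [← prod_Ioc_shift_one_div hip hpq]
      refine Finset.prod_congr rfl fun j hj => ?_
      obtain ⟨hj1, hj2⟩ := Finset.mem_Ioc.1 hj
      rw [hlam, hlam, if_pos hip, if_neg (by omega), if_pos hj2, sub_zero]
    have h2 : ∏ j ∈ Finset.Ioc q n, (lam i - lam j + (j : ℚ) - i) / ((j : ℚ) - i) =
        ((n : ℚ) - i + 1) * ((n : ℚ) - i + 2) / (((q : ℚ) - i + 1) * ((q : ℚ) - i + 2)) := by
      rw [← prod_Ioc_shift_two_div (hip.trans hpq) hqn]
      refine Finset.prod_congr rfl fun j hj => ?_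
      obtain ⟨hj1, hj2⟩ := Finset.mem_Ioc.1 hj
      rw [hlam, hlam, if_pos hip, if_neg (by omega), if_neg (by omega)]
      norm_num
    rw [h1, h2]
    have hp' : (i : ℚ) ≤ p := by exact_mod_cast hip
    have hq' : (p : ℚ) ≤ q := by exact_mod_cast hpq
    have e1 : (p : ℚ) - i + 1 ≠ 0 := by linarith
    have e2 : (q : ℚ) - i + 1 ≠ 0 := by linarith
    have e3 : (q : ℚ) - i + 2 ≠ 0 := by linarith
    have e4 : (q : ℚ) + 1 - i + 1 ≠ 0 := by linarith
    push_cast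
    field_simp
    ring
  have inner_mid : ∀ i ∈ Finset.Ioc p q,
      ∏ j ∈ Finset.Ioc i n, (lam i - lam j + (j : ℚ) - i) / ((j : ℚ) - i) =
        ((n : ℚ) - i + 1) / ((q : ℚ) - i + 1) := by
    intro i hi
    obtain ⟨hpi, hiq⟩ := Finset.mem_Ioc.1 hi
    rw [← prod_Ioc_mul_prod_Ioc _ hiq hqn,
      inner_eq_one i i q le_rfl (by
        intro j hj
        obtain ⟨hj1, hj2⟩ := Finset.mem_Ioc.1 hj
        rw [hlam, hlam, if_neg (by omega), if_pos hiq, if_neg (by omega), if_pos hj2]), one_mul,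
      ← prod_Ioc_shift_one_div hiq hqn]
    refine Finset.prod_congr rfl fun j hj => ?_
    obtain ⟨hj1, hj2⟩ := Finset.mem_Ioc.1 hj
    rw [hlam, hlam, if_neg (by omega), if_pos hiq, if_neg (by omega), if_neg (by omega)]
    norm_num
  have inner_high : ∀ i ∈ Finset.Ioc q n,
      ∏ j ∈ Finset.Ioc i n, (lam i - lam j + (j : ℚ) - i) / ((j : ℚ) - i) = 1 := by
    intro i hi
    obtain ⟨hqi, -⟩ := Finset.mem_Ioc.1 hi
    refine inner_eq_one i i n le_rfl fun j hj => ?_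
    obtain ⟨hj1, hj2⟩ := Finset.mem_Ioc.1 hj
    rw [hlam, hlam, if_neg (by omega), if_neg (by omega), if_neg (by omega), if_neg (by omega)]
  have hIcc : ∀ i, Finset.Icc (i + 1) n = Finset.Ioc i n := fun i => by
    ext j
    simp only [Finset.mem_Icc, Finset.mem_Ioc]
    omega
  simp only [hIcc]
  rw [← prod_Ioc_mul_prod_Ioc _ (Nat.zero_le q) hqn, ← prod_Ioc_mul_prod_Ioc _ (Nat.zero_le p) hpq,
    Finset.prod_congr rfl inner_low, Finset.prod_congr rfl inner_mid,
    Finset.prod_congr rfl inner_high, Finset.prod_const_one, mul_one,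
    Finset.prod_div_distrib, Finset.prod_div_distrib, Finset.prod_mul_distrib,
    Finset.prod_mul_distrib, prod_Ioc_sub_add_one (Nat.zero_le p) (by omega),
    prod_Ioc_sub_add_one (Nat.zero_le p) (by omega),
    prod_Ioc_sub_add_one (Nat.zero_le p) le_rfl,
    prod_Ioc_sub_add_one (Nat.zero_le p) (by omega),
    prod_Ioc_sub_add_one hpq hqn, prod_Ioc_sub_add_one hpq le_rfl,
    Nat.cast_choose ℚ (show p ≤ n + 1 by omega), Nat.cast_choose ℚ (show n - q ≤ n + 1 by omega),
    show n + 1 - (n - q) = q + 1 by omega, show q + 1 - p = q - p + 1 by omega,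
    Nat.factorial_succ n, Nat.factorial_succ (q - p)]
  have hfac : ∀ m : ℕ, (m.factorial : ℚ) ≠ 0 := fun m => by
    exact_mod_cast m.factorial_ne_zero
  have e1 := hfac (n + 1 - p)
  have e2 := hfac (n - p)
  have e3 := hfac p
  have e4 := hfac (q + 1)
  have e5 := hfac (n - q)
  have e6 := hfac (q - p)
  have e7 : (n : ℚ) + 1 ≠ 0 := by positivity
  simp only [Nat.sub_zero, Nat.sub_self, Nat.factorial_zero, Nat.cast_one, Nat.factorial_succ n,
    Nat.cast_mul, Nat.cast_add, Nat.cast_sub hpq]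
  field_simp
end

section
/- Let n ≥ 2 and k ≥ 0 be integers. Define λ ∈ ℚⁿ by λ₁ = k, λ_n = −k, and λ_i = 0 otherwise. Then ∏_{1≤i<j≤n} (λ_i − λ_j + j − i)/(j − i) = ((n+2k−1) · C(n+k−2, k)²) / (n−1) in ℚ. (This is the paper's formula for the dimension of the Cartan power g^{(k)} of su(n), the irreducible with highest weight (k, 0^{n−2}, −k).) -/
theorem prod_range_add_div_eq_choose (m k : ℕ) :
    ∏ r ∈ Finset.range m, ((k : ℚ) + (r + 1)) / ((r : ℚ) + 1) = ((m + k).choose k : ℚ) := by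
  induction m with
  | zero => simp
  | succ m ih =>
    rw [Finset.prod_range_succ, ih]
    have h : ((m + k + 1).choose k : ℚ) * (m + 1) = (m + k).choose k * (m + k + 1) := by
      have h := Nat.choose_mul_succ_eq (m + k) k
      rw [show m + k + 1 - k = m + 1 by omega] at h
      exact_mod_cast h.symm
    rw [show m + 1 + k = m + k + 1 by ring]
    field_simp
    linarith

theorem prod_Icc_eq_prod_range (a b : ℕ) (f : ℕ → ℚ) :
    ∏ i ∈ Finset.Icc a b, f i = ∏ r ∈ Finset.range (b + 1 - a), f (a + r) :=
  Finset.prod_Ico_eq_prod_range f a (b + 1)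

/-- For `n ≥ 2` and `k ≥ 0`, with `λ₁ = k`, `λ_n = −k`, `λ_i = 0` otherwise,
Weyl's dimension formula gives
`∏_{1≤i<j≤n} (λ_i − λ_j + j − i)/(j − i) = ((n+2k−1)·C(n+k−2,k)²)/(n−1)`. -/
theorem stmt_13 (n k : ℕ) (hn : 2 ≤ n) (lam : ℕ → ℚ)
    (hlam : ∀ i, lam i = if i = 1 then (k : ℚ) else if i = n then -(k : ℚ) else 0) :
    ∏ i ∈ Finset.Icc 1 n, ∏ j ∈ Finset.Icc (i + 1) n,
        (lam i - lam j + (j : ℚ) - i) / ((j : ℚ) - i) =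
      ((n : ℚ) + 2 * k - 1) * ((n + k - 2).choose k : ℚ) ^ 2 / ((n : ℚ) - 1) := by
  obtain ⟨m, rfl⟩ := Nat.exists_eq_add_of_le' hn
  have lam_one : lam 1 = k := by simp [hlam]
  have lam_last : lam (m + 2) = -k := by simp [hlam]
  have lam_mid : ∀ i, 2 ≤ i → i ≤ m + 1 → lam i = 0 := fun i h₁ h₂ => by
    rw [hlam, if_neg (by omega), if_neg (by omega)]
  have first_row : ∏ j ∈ Finset.Icc (1 + 1) (m + 2),
      (lam 1 - lam j + (j : ℚ) - (1 : ℕ)) / ((j : ℚ) - (1 : ℕ)) =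
        (m + k).choose k * ((m + 2 * k + 1) / (m + 1)) := by
    rw [prod_Icc_eq_prod_range, show m + 2 + 1 - (1 + 1) = m + 1 by omega,
      Finset.prod_range_succ, ← prod_range_add_div_eq_choose]
    congr 1
    · refine Finset.prod_congr rfl fun r hr => ?_
      rw [Finset.mem_range] at hr
      rw [lam_one, lam_mid _ (by omega) (by omega)]
      push_cast
      congr 1 <;> ring
    · rw [show 1 + 1 + m = m + 2 by ring, lam_one, lam_last]
      push_cast
      congr 1 <;> ring
  have middle_row : ∀ r ∈ Finset.range m, ∏ j ∈ Finset.Icc (1 + (r + 1) + 1) (m + 2),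
      (lam (1 + (r + 1)) - lam j + (j : ℚ) - (1 + (r + 1) : ℕ)) /
          ((j : ℚ) - (1 + (r + 1) : ℕ)) =
        ((k : ℚ) + ((m - 1 - r : ℕ) + 1)) / (((m - 1 - r : ℕ) : ℚ) + 1) := by
    intro r hr
    rw [Finset.mem_range] at hr
    have hcast : ((m - 1 - r : ℕ) : ℚ) = m - 1 - r := by
      rw [Nat.cast_sub (by omega), Nat.cast_sub (by omega), Nat.cast_one]
    rw [Finset.prod_eq_single (m + 2), lam_mid _ (by omega) (by omega), lam_last, hcast]
    · push_cast
      congr 1 <;> ring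
    · intro j hj hne
      rw [Finset.mem_Icc] at hj
      rw [lam_mid _ (by omega) (by omega), lam_mid j (by omega) (by omega), sub_self, zero_add]
      have hlt : ((1 + (r + 1) : ℕ) : ℚ) < j := by exact_mod_cast hj.1
      exact div_self (sub_pos.mpr hlt).ne'
    · intro h
      exact absurd (Finset.mem_Icc.mpr ⟨by omega, le_rfl⟩) h
  rw [prod_Icc_eq_prod_range, show m + 2 + 1 - 1 = m + 1 + 1 by omega, Finset.prod_range_succ,
    Finset.prod_range_succ', Finset.prod_congr rfl middle_row,
    Finset.prod_range_reflect (fun r : ℕ => ((k : ℚ) + ((r : ℚ) + 1)) / ((r : ℚ) + 1)),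
    prod_range_add_div_eq_choose, add_zero, first_row,
    Finset.Icc_eq_empty (by omega), Finset.prod_empty, show m + 2 + k - 2 = m + k by omega]
  push_cast
  rw [show (m : ℚ) + 2 - 1 = m + 1 by ring]
  ring
end

section
/- Let n, k, r be integers with 0 ≤ r ≤ k and k + r ≤ n. Define λ ∈ ℚⁿ by λ_i = 2 for 1 ≤ i ≤ k−r, λ_i = 1 for k−r < i ≤ k+r, and λ_i = 0 for k+r < i ≤ n. Then ∏_{1≤i<j≤n} (λ_i − λ_j + j − i)/(j − i) = ((2r+1) · C(n+1, k−r) · C(n+1, n−k−r)) / (n+1) in ℚ. (This is the paper's formula for the dimension of the irreducible component of ⊗²(∧^k V) with highest weight (2^{k−r}, 1^{2r}, 0^{n−k−r}) for SU(n); the case r = 0 gives the Cartan square dim (∧^k V)^{(2)} = C(n+1,k)·C(n+1,k+1)/(n+1).) -/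
theorem prod_Ico_telescope (x : ℚ) (s e : ℕ) (hse : s ≤ e) (hx : (e : ℚ) < x + 1) :
    ∏ i ∈ Finset.Ico s e, (1 + x - i) / (x - i) = (x - s + 1) / (x - e + 1) := by
  induction e, hse using Nat.le_induction with
  | base =>
    rw [Finset.Ico_self, Finset.prod_empty, div_self]
    linarith
  | succ e hse ih =>
    push_cast at hx ⊢
    rw [Finset.prod_Ico_succ_top hse, ih (by linarith)]
    have h1 : x - e ≠ 0 := by linarith
    have h2 : x - e + 1 ≠ 0 := by linarith
    have h3 : x - (e + 1) + 1 ≠ 0 := by linarith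
    field_simp
    ring

theorem prod_Ico_telescope_two (x : ℚ) (s e : ℕ) (hse : s ≤ e) (hx : (e : ℚ) < x + 1) :
    ∏ i ∈ Finset.Ico s e, (2 + x - i) / (x - i) =
      (x - s + 2) * (x - s + 1) / ((x - e + 2) * (x - e + 1)) := by
  have h : ∀ i ∈ Finset.Ico s e, (2 + x - i) / (x - i) =
      ((1 + (x + 1) - i) / (x + 1 - i)) * ((1 + x - i) / (x - i)) := by
    intro i hi
    have hi' : (i : ℚ) + 1 ≤ e := by exact_mod_cast (Finset.mem_Ico.mp hi).2
    have h1 : x - i ≠ 0 := by linarith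
    have h2 : x + 1 - i ≠ 0 := by linarith
    field_simp
    ring
  rw [Finset.prod_congr rfl h, Finset.prod_mul_distrib,
    prod_Ico_telescope _ s e hse (by linarith), prod_Ico_telescope _ s e hse hx,
    div_mul_div_comm]
  ring

/-- The factors of Weyl's product in column `j`. -/
def weylColumn (lam : ℕ → ℚ) (j : ℕ) : ℚ :=
  ∏ i ∈ Finset.Ico 1 j, (lam i - lam j + (j : ℚ) - i) / ((j : ℚ) - i)

theorem prod_weyl_factor_eq_one {lam : ℕ → ℚ} {s e j : ℕ} (hej : e ≤ j)
    (h : ∀ i ∈ Finset.Ico s e, lam i = lam j) :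
    ∏ i ∈ Finset.Ico s e, (lam i - lam j + (j : ℚ) - i) / ((j : ℚ) - i) = 1 := by
  refine Finset.prod_eq_one fun i hi => ?_
  have hi' : (i : ℚ) + 1 ≤ j := by exact_mod_cast (Finset.mem_Ico.mp hi).2.trans_le hej
  rw [h i hi, sub_self, zero_add, div_self]
  linarith

section TwoColumns

variable {a b : ℕ} {lam : ℕ → ℚ}
  (hlam : ∀ i, lam i = if i ≤ a then (2 : ℚ) else if i ≤ a + b then 1 else 0)

include hlam

theorem weylColumn_of_le {j : ℕ} (hj : j ≤ a) : weylColumn lam j = 1 := by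
  refine prod_weyl_factor_eq_one le_rfl fun i hi => ?_
  have := Finset.mem_Ico.mp hi
  rw [hlam, hlam, if_pos (by omega), if_pos hj]

theorem weylColumn_of_mem_middle {j : ℕ} (haj : a < j) (hj : j ≤ a + b) :
    weylColumn lam j = j / ((j : ℚ) - a) := by
  have haj' : (a : ℚ) + 1 ≤ j := by exact_mod_cast haj
  rw [weylColumn, ← Finset.prod_Ico_consecutive _ (by omega : 1 ≤ a + 1) haj,
    prod_weyl_factor_eq_one (s := a + 1) le_rfl, mul_one]
  · have h : ∀ i ∈ Finset.Ico 1 (a + 1), (lam i - lam j + (j : ℚ) - i) / ((j : ℚ) - i) =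
        (1 + (j : ℚ) - i) / ((j : ℚ) - i) := by
      intro i hi
      have := Finset.mem_Ico.mp hi
      rw [hlam, hlam, if_pos (by omega), if_neg (by omega), if_pos hj]
      norm_num
    rw [Finset.prod_congr rfl h,
      prod_Ico_telescope _ _ _ (by omega) (by push_cast; linarith)]
    push_cast
    congr 1 <;> ring
  · intro i hi
    have := Finset.mem_Ico.mp hi
    rw [hlam, hlam, if_neg (by omega), if_pos (by omega), if_neg (by omega), if_pos hj]

theorem weylColumn_of_lt {j : ℕ} (hj : a + b < j) :
    weylColumn lam j = (j + 1) * j / (((j : ℚ) - a + 1) * (j - a - b)) := by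
  have hj' : (a : ℚ) + b + 1 ≤ j := by exact_mod_cast hj
  have hb : (0 : ℚ) ≤ b := b.cast_nonneg
  rw [weylColumn, ← Finset.prod_Ico_consecutive _ (by omega : 1 ≤ a + 1) (by omega : a + 1 ≤ j),
    ← Finset.prod_Ico_consecutive _ (by omega : a + 1 ≤ a + b + 1) hj,
    prod_weyl_factor_eq_one (s := a + b + 1) le_rfl, mul_one]
  · have h2 : ∀ i ∈ Finset.Ico 1 (a + 1), (lam i - lam j + (j : ℚ) - i) / ((j : ℚ) - i) =
        (2 + (j : ℚ) - i) / ((j : ℚ) - i) := by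
      intro i hi
      have := Finset.mem_Ico.mp hi
      rw [hlam, hlam, if_pos (by omega), if_neg (by omega), if_neg (by omega), sub_zero]
    have h1 : ∀ i ∈ Finset.Ico (a + 1) (a + b + 1),
        (lam i - lam j + (j : ℚ) - i) / ((j : ℚ) - i) = (1 + (j : ℚ) - i) / ((j : ℚ) - i) := by
      intro i hi
      have := Finset.mem_Ico.mp hi
      rw [hlam, hlam, if_neg (by omega), if_pos (by omega), if_neg (by omega),
        if_neg (by omega), sub_zero]
    rw [Finset.prod_congr rfl h2, Finset.prod_congr rfl h1,
      prod_Ico_telescope_two _ _ _ (by omega) (by push_cast; linarith),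
      prod_Ico_telescope _ _ _ (by omega) (by push_cast; linarith)]
    push_cast
    have e1 : (j : ℚ) - (a + 1) + 2 = j - a + 1 := by ring
    have e2 : (j : ℚ) - (a + 1) + 1 = j - a := by ring
    have e3 : (j : ℚ) - (a + b + 1) + 1 = j - a - b := by ring
    rw [e1, e2, e3]
    have n1 : (j : ℚ) - a + 1 ≠ 0 := by linarith
    have n2 : (j : ℚ) - a ≠ 0 := by linarith
    have n3 : (j : ℚ) - a - b ≠ 0 := by linarith
    field_simp
    ring
  · intro i hi
    have := Finset.mem_Ico.mp hi
    rw [hlam, hlam, if_neg (by omega), if_neg (by omega), if_neg (by omega), if_neg (by omega)]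

theorem prod_weylColumn_of_le (m : ℕ) (hm : m ≤ b) :
    ∏ j ∈ Finset.Icc 1 (a + m), weylColumn lam j = (a + m).choose a := by
  induction m with
  | zero =>
    rw [add_zero, Nat.choose_self, Nat.cast_one]
    exact Finset.prod_eq_one fun j hj => weylColumn_of_le hlam (Finset.mem_Icc.mp hj).2
  | succ m ih =>
    rw [← add_assoc, Finset.prod_Icc_succ_top (by omega), ih (by omega),
      weylColumn_of_mem_middle hlam (by omega) (by omega)]
    have h : ((a + m).choose a : ℚ) * (a + m + 1) = (a + m + 1).choose a * (m + 1) := by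
      have := Nat.choose_mul_succ_eq (a + m) a
      rw [show a + m + 1 - a = m + 1 by omega] at this
      exact_mod_cast this
    push_cast
    rw [show (a : ℚ) + m + 1 - a = m + 1 by ring, ← mul_div_assoc, h,
      mul_div_cancel_right₀ _ (by positivity)]

theorem prod_weylColumn (c : ℕ) :
    ∏ j ∈ Finset.Icc 1 (a + b + c), weylColumn lam j =
      (b + 1) * ((a + b + c + 1).choose a) * ((a + b + c + 1).choose c) /
        ((a : ℚ) + b + c + 1) := by
  induction c with
  | zero =>
    rw [add_zero, prod_weylColumn_of_le hlam b le_rfl]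
    have h : ((a + b).choose a : ℚ) * (a + b + 1) = (a + b + 1).choose a * (b + 1) := by
      have := Nat.choose_mul_succ_eq (a + b) a
      rw [show a + b + 1 - a = b + 1 by omega] at this
      exact_mod_cast this
    rw [eq_div_iff (by positivity)]
    simp only [Nat.choose_zero_right, Nat.cast_zero, Nat.cast_one, add_zero]
    linarith
  | succ c ih =>
    rw [← add_assoc, Finset.prod_Icc_succ_top (by omega), ih, weylColumn_of_lt hlam (by omega)]
    have h1 : ((a + b + c + 1).choose a : ℚ) * (a + b + c + 1 + 1) =
        (a + b + c + 1 + 1).choose a * (b + c + 2) := by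
      have := Nat.choose_mul_succ_eq (a + b + c + 1) a
      rw [show a + b + c + 1 + 1 - a = b + c + 2 by omega] at this
      exact_mod_cast this
    have h2 : ((a : ℚ) + b + c + 1 + 1) * (a + b + c + 1).choose c =
        (a + b + c + 1 + 1).choose (c + 1) * (c + 1) := by
      exact_mod_cast Nat.add_one_mul_choose_eq (a + b + c + 1) c
    rw [← eq_div_iff (by positivity)] at h1
    rw [mul_comm, ← eq_div_iff (by positivity)] at h2
    rw [h1, h2]
    push_cast
    rw [show (a : ℚ) + b + c + 1 - a + 1 = b + c + 2 by ring,
      show (a : ℚ) + b + c + 1 - a - b = c + 1 by ring]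
    field_simp
    ring

end TwoColumns

/-- For `0 ≤ r ≤ k` and `k + r ≤ n`, with `λ_i = 2` for `1 ≤ i ≤ k−r`, `λ_i = 1` for
`k−r < i ≤ k+r`, and `λ_i = 0` for `k+r < i ≤ n`, Weyl's dimension formula gives
`∏_{1≤i<j≤n} (λ_i − λ_j + j − i)/(j − i) = ((2r+1)·C(n+1,k−r)·C(n+1,n−k−r))/(n+1)`. -/
theorem stmt_14 (n k r : ℕ) (hrk : r ≤ k) (hkn : k + r ≤ n) (lam : ℕ → ℚ)
    (hlam : ∀ i, lam i = if i ≤ k - r then (2 : ℚ) else if i ≤ k + r then 1 else 0) :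
    ∏ i ∈ Finset.Icc 1 n, ∏ j ∈ Finset.Icc (i + 1) n,
        (lam i - lam j + (j : ℚ) - i) / ((j : ℚ) - i) =
      (2 * (r : ℚ) + 1) * ((n + 1).choose (k - r)) * ((n + 1).choose (n - k - r)) /
        ((n : ℚ) + 1) := by
  obtain ⟨a, rfl⟩ := Nat.exists_eq_add_of_le' hrk
  obtain ⟨c, rfl⟩ := Nat.exists_eq_add_of_le hkn
  have e1 : a + r - r = a := by omega
  have e2 : a + r + r + c - (a + r) - r = c := by omega
  have e3 : a + r + r = a + 2 * r := by omega
  rw [e2]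
  simp only [e1, e3] at hlam ⊢
  have h := prod_weylColumn hlam c
  push_cast at h ⊢
  rw [← h]
  exact Finset.prod_comm' fun i j => by simp only [Finset.mem_Icc, Finset.mem_Ico]; omega
end

section
/- Let n and k be integers with 0 ≤ k ≤ n−1. Define λ ∈ ℚⁿ by λ_i = 1 for 1 ≤ i ≤ k, λ_n = −k, and λ_i = 0 otherwise. Then ∏_{1≤i<j≤n} (λ_i − λ_j + j − i)/(j − i) = C(n−1, k) · C(n+k, k), and moreover C(n−1, k) · C(n+k, k) · (k!)² = ∏_{r=1}^{k} (n² − r²). (This is the paper's dimension formula for the irreducible submodule g^{(1^k,−k)} ⊂ hom(S^k V, ∧^k V) of su(n).) -/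
open Finset in
theorem prod_range_add_div_eq_choose_s15 (a d : ℕ) :
    ∏ i ∈ range d, ((a : ℚ) + d - i) / ((d : ℚ) - i) = ((a + d).choose d : ℚ) := by
  have h : ∏ i ∈ range d, ((a : ℚ) + i + 1) / ((i : ℚ) + 1) = ((a + d).choose d : ℚ) := by
    induction d with
    | zero => simp
    | succ d ih =>
      rw [prod_range_succ, ih]
      have h1 := Nat.add_one_mul_choose_eq (a + d) d
      have h2 : ((a : ℚ) + d + 1) * ((a + d).choose d : ℚ) =
          ((a + (d + 1)).choose (d + 1) : ℚ) * (d + 1) := by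
        exact_mod_cast h1
      have h3 : (d : ℚ) + 1 ≠ 0 := by positivity
      field_simp
      linarith
  rw [← h, ← prod_range_reflect]
  refine prod_congr rfl fun i hi => ?_
  have hi' : i + 1 ≤ d := mem_range.mp hi
  have hc : ((d - 1 - i : ℕ) : ℚ) = (d : ℚ) - 1 - i := by
    rw [Nat.sub_sub, Nat.cast_sub (by lia)]
    push_cast
    ring
  rw [hc]
  congr 1 <;> ring

open Finset in
theorem choose_mul_choose_mul_factorial_sq (n k : ℕ) :
    (n - 1).choose k * (n + k).choose k * k.factorial ^ 2 =
      ∏ r ∈ Icc 1 k, (n ^ 2 - r ^ 2) := by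
  have h1 := Nat.descFactorial_eq_factorial_mul_choose (n - 1) k
  have h2 := Nat.ascFactorial_eq_factorial_mul_choose n k
  rw [Nat.descFactorial_eq_prod_range] at h1
  rw [Nat.ascFactorial_eq_prod_range] at h2
  calc _ = (k.factorial * (n - 1).choose k) * (k.factorial * (n + k).choose k) := by ring
    _ = ∏ i ∈ range k, (n ^ 2 - (1 + i) ^ 2) := by
      rw [← h1, ← h2, ← prod_mul_distrib]
      refine prod_congr rfl fun i _ => ?_
      rw [Nat.sq_sub_sq, mul_comm, Nat.sub_sub, add_assoc]
    _ = _ := by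
      rw [← Ico_add_one_right_eq_Icc, prod_Ico_eq_prod_range, Nat.add_sub_cancel]

/-- Telescoping product over the columns `k < j ≤ M`, where the weight drops from `1` to `0`. -/
theorem prod_Icc_weyl_factor_of_le (lam : ℕ → ℚ) (i k M : ℕ) (hik : i ≤ k) (hkM : k ≤ M)
    (hi : lam i = 1) (h1 : ∀ j, i < j → j ≤ k → lam j = 1)
    (h0 : ∀ j, k < j → j ≤ M → lam j = 0) :
    ∏ j ∈ Finset.Icc (i + 1) M, (lam i - lam j + (j : ℚ) - i) / ((j : ℚ) - i) =
      ((M : ℚ) + 1 - i) / ((k : ℚ) + 1 - i) := by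
  have hk : (i : ℚ) ≤ k := by exact_mod_cast hik
  induction M, hkM using Nat.le_induction with
  | base =>
    rw [div_self (by linarith)]
    refine Finset.prod_eq_one fun j hj => ?_
    obtain ⟨hij, hjk⟩ := Finset.mem_Icc.mp hj
    have : (i : ℚ) + 1 ≤ j := by exact_mod_cast hij
    rw [hi, h1 j hij hjk, sub_self, zero_add, div_self (by linarith)]
  | succ M hkM ih =>
    have hM : (k : ℚ) ≤ M := by exact_mod_cast hkM
    have hne : (M : ℚ) + 1 - i ≠ 0 := by linarith
    have hne' : (k : ℚ) + 1 - i ≠ 0 := by linarith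
    rw [Finset.prod_Icc_succ_top (by lia), ih fun j hj hjM => h0 j hj (by lia), hi,
      h0 (M + 1) (by lia) le_rfl]
    push_cast
    field_simp
    ring


/-- For `0 ≤ k ≤ n−1`, with `λ_i = 1` for `1 ≤ i ≤ k`, `λ_n = −k`, `λ_i = 0` otherwise,
Weyl's dimension formula gives
`∏_{1≤i<j≤n} (λ_i − λ_j + j − i)/(j − i) = C(n−1,k)·C(n+k,k)`, and moreover
`C(n−1,k)·C(n+k,k)·(k!)² = ∏_{r=1}^{k} (n² − r²)`. -/
theorem stmt_15 (n k : ℕ) (hkn : k + 1 ≤ n) (lam : ℕ → ℚ)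
    (hlam : ∀ i, lam i = if 1 ≤ i ∧ i ≤ k then (1 : ℚ) else if i = n then -(k : ℚ) else 0) :
    (∏ i ∈ Finset.Icc 1 n, ∏ j ∈ Finset.Icc (i + 1) n,
        (lam i - lam j + (j : ℚ) - i) / ((j : ℚ) - i) =
      ((n - 1).choose k * (n + k).choose k : ℚ)) ∧
      (n - 1).choose k * (n + k).choose k * k.factorial ^ 2 =
        ∏ r ∈ Finset.Icc 1 k, (n ^ 2 - r ^ 2) := by
  refine ⟨?_, choose_mul_choose_mul_factorial_sq n k⟩
  obtain ⟨d, rfl⟩ : ∃ d, n = k + d + 1 := ⟨n - k - 1, by lia⟩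
  have hone : ∀ j, 1 ≤ j → j ≤ k → lam j = 1 := fun j h h' => by rw [hlam, if_pos ⟨h, h'⟩]
  have hzero : ∀ j, k < j → j ≤ k + d → lam j = 0 := fun j h h' => by
    rw [hlam, if_neg (by lia), if_neg (by lia)]
  have hlast : lam (k + d + 1) = -k := by rw [hlam, if_neg (by lia), if_pos rfl]
  rw [Finset.prod_Icc_succ_top (by lia), Finset.Icc_eq_empty (a := k + d + 1 + 1) (by lia),
    Finset.prod_empty, mul_one, ← Finset.Ico_add_one_right_eq_Icc, Finset.prod_Ico_eq_prod_range,
    Nat.add_sub_cancel, Finset.prod_range_add, mul_comm,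
    Nat.choose_symm_add, ← prod_range_add_div_eq_choose_s15 k d,
    ← prod_range_add_div_eq_choose_s15 (k + d + 1) k]
  congr 1 <;> refine Finset.prod_congr rfl fun i hi => ?_ <;> rw [Finset.mem_range] at hi
  · have hid : (i : ℚ) + 1 ≤ d := by exact_mod_cast hi
    rw [Finset.prod_Icc_succ_top (by lia), Finset.prod_eq_one, one_mul,
      hzero (1 + (k + i)) (by lia) (by lia), hlast]
    · push_cast
      congr 1 <;> ring
    · intro j hj
      obtain ⟨hij, hjm⟩ := Finset.mem_Icc.mp hj
      have : ((1 + (k + i) : ℕ) : ℚ) + 1 ≤ j := by exact_mod_cast hij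
      rw [hzero (1 + (k + i)) (by lia) (by lia), hzero j (by lia) hjm, sub_self, zero_add,
        div_self (by linarith)]
  · have hik : (i : ℚ) + 1 ≤ k := by exact_mod_cast hi
    have hi1 : lam (1 + i) = 1 := hone _ (by lia) (by lia)
    rw [Finset.prod_Icc_succ_top (by lia),
      prod_Icc_weyl_factor_of_le lam (1 + i) k (k + d) (by lia) (by lia) hi1
        (fun j h h' => hone j (by lia) h') hzero, hi1, hlast]
    have hd : (0 : ℚ) ≤ d := by positivity
    push_cast
    have e1 : (k : ℚ) + 1 - (1 + i) = k - i := by ring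
    have e2 : (k : ℚ) + d + 1 - (1 + i) = k + d - i := by ring
    have n1 : (k : ℚ) - i ≠ 0 := by linarith
    have n2 : (k : ℚ) + d - i ≠ 0 := by linarith
    rw [e1, e2]
    field_simp
    ring
end

section
/- Let ℓ ≥ 2, m ≥ 1, and b be integers with 1 ≤ b < ℓ, and set n = 2ℓ. Define λ ∈ ℚ^ℓ by λ_j = m for 1 ≤ j ≤ b and λ_j = 0 otherwise, and δ_j = ℓ − j. Then ∏_{1≤i<j≤ℓ} ((λ_i+δ_i)² − (λ_j+δ_j)²)/(δ_i² − δ_j²) = [∏_{i=1}^{b} ∏_{j=b+1}^{n−b−1} (j−i+m)/(j−i)] · [∏_{1≤i≤j≤b} (2m+n−i−j)/(n−i−j)] in ℚ. (This is the paper's reduction of Weyl's dimension formula for SO(2ℓ) at the highest weight (m^b, 0^{ℓ−b}).) -/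
/-- Folding a product over an interval symmetric about `ℓ`; the midpoint is counted twice. -/
theorem prod_Icc_mul_reflect {M : Type*} [CommMonoid M] (f : ℕ → M) {b ℓ : ℕ} (h : b < ℓ) :
    ∏ j ∈ Finset.Icc (b + 1) ℓ, f j * f (2 * ℓ - j) =
      (∏ j ∈ Finset.Icc (b + 1) (2 * ℓ - b - 1), f j) * f ℓ := by
  have hreflect := Finset.prod_Ico_reflect f (b + 1) (m := ℓ) (n := 2 * ℓ) (by omega)
  rw [show 2 * ℓ + 1 - ℓ = ℓ + 1 by omega,
    show 2 * ℓ + 1 - (b + 1) = 2 * ℓ - b by omega] at hreflect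
  rw [← Finset.Ico_add_one_right_eq_Icc, ← Finset.Ico_add_one_right_eq_Icc,
    show 2 * ℓ - b - 1 + 1 = 2 * ℓ - b by omega, Finset.prod_mul_distrib,
    Finset.prod_Ico_succ_top (f := fun j => f (2 * ℓ - j)) (by omega), hreflect,
    ← mul_assoc, Finset.prod_Ico_consecutive f (by omega) (by omega),
    show 2 * ℓ - ℓ = ℓ by omega]

/-- For `ℓ ≥ 2`, `m ≥ 1`, `1 ≤ b < ℓ`, `n = 2ℓ`, with `λ_j = m` for `1 ≤ j ≤ b`,
`λ_j = 0` otherwise, and `δ_j = ℓ − j`, Weyl's dimension formula for `SO(2ℓ)` reduces: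
`∏_{1≤i<j≤ℓ} ((λ_i+δ_i)² − (λ_j+δ_j)²)/(δ_i² − δ_j²) =`
`[∏_{i=1}^{b} ∏_{j=b+1}^{n−b−1} (j−i+m)/(j−i)] · [∏_{1≤i≤j≤b} (2m+n−i−j)/(n−i−j)]`. -/
theorem stmt_16 (ℓ m b n : ℕ) (hℓ : 2 ≤ ℓ) (hm : 1 ≤ m) (hb1 : 1 ≤ b) (hbℓ : b < ℓ)
    (hn : n = 2 * ℓ) (lam : ℕ → ℚ) (hlam : ∀ j, lam j = if j ≤ b then (m : ℚ) else 0)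
    (δ : ℕ → ℚ) (hδ : ∀ j, δ j = (ℓ : ℚ) - j) :
    ∏ i ∈ Finset.Icc 1 ℓ, ∏ j ∈ Finset.Icc (i + 1) ℓ,
        ((lam i + δ i) ^ 2 - (lam j + δ j) ^ 2) / ((δ i) ^ 2 - (δ j) ^ 2) =
      (∏ i ∈ Finset.Icc 1 b, ∏ j ∈ Finset.Icc (b + 1) (n - b - 1),
          ((j : ℚ) - i + m) / ((j : ℚ) - i)) *
        ∏ i ∈ Finset.Icc 1 b, ∏ j ∈ Finset.Icc i b,
          (2 * (m : ℚ) + n - i - j) / ((n : ℚ) - i - j) := by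
  have hδne : ∀ i j : ℕ, 1 ≤ i → i < j → j ≤ ℓ → δ i ^ 2 - δ j ^ 2 ≠ 0 := by
    intro i j _ hij hj
    have hij' : (i : ℚ) < j := by exact_mod_cast hij
    have hj' : (j : ℚ) ≤ ℓ := by exact_mod_cast hj
    rw [hδ, hδ]
    nlinarith
  have hsub : Finset.Icc 1 b ⊆ Finset.Icc 1 ℓ := Finset.Icc_subset_Icc_right hbℓ.le
  rw [← Finset.prod_subset hsub, ← Finset.prod_mul_distrib]
  · refine Finset.prod_congr rfl fun i hi => ?_
    obtain ⟨hi1, hib⟩ := Finset.mem_Icc.mp hi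
    have hib' : (i : ℚ) ≤ b := by exact_mod_cast hib
    have hbℓ' : (b : ℚ) < ℓ := by exact_mod_cast hbℓ
    have hsplit : ∀ g : ℕ → ℚ, ∏ j ∈ Finset.Icc (i + 1) ℓ, g j =
        (∏ j ∈ Finset.Icc (i + 1) b, g j) * ∏ j ∈ Finset.Icc (b + 1) ℓ, g j := by
      intro g
      simp only [← Finset.Ico_add_one_right_eq_Icc]
      rw [Finset.prod_Ico_consecutive g (by omega) (by omega)]
    have hlow : ∏ j ∈ Finset.Icc (i + 1) b,
          ((lam i + δ i) ^ 2 - (lam j + δ j) ^ 2) / ((δ i) ^ 2 - (δ j) ^ 2) =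
        ∏ j ∈ Finset.Icc (i + 1) b, (2 * (m : ℚ) + n - i - j) / ((n : ℚ) - i - j) := by
      refine Finset.prod_congr rfl fun j hj => ?_
      obtain ⟨hij, hjb⟩ := Finset.mem_Icc.mp hj
      have hjb' : (j : ℚ) ≤ b := by exact_mod_cast hjb
      have hne : (n : ℚ) - i - j ≠ 0 := by
        rw [hn]; push_cast; linarith
      rw [div_eq_div_iff (hδne i j hi1 (by omega) (by omega)) hne, hlam, hlam, if_pos hib,
        if_pos hjb, hδ, hδ, hn]
      push_cast
      ring
    have hhigh : ∏ j ∈ Finset.Icc (b + 1) ℓ,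
          ((lam i + δ i) ^ 2 - (lam j + δ j) ^ 2) / ((δ i) ^ 2 - (δ j) ^ 2) =
        ∏ j ∈ Finset.Icc (b + 1) ℓ, (((j : ℚ) - i + m) / ((j : ℚ) - i)) *
          ((((2 * ℓ - j : ℕ) : ℚ) - i + m) / (((2 * ℓ - j : ℕ) : ℚ) - i)) := by
      refine Finset.prod_congr rfl fun j hj => ?_
      obtain ⟨hbj, hjℓ⟩ := Finset.mem_Icc.mp hj
      rw [Nat.cast_sub (by omega), div_mul_div_comm, hlam, hlam, if_pos hib,
        if_neg (by omega), hδ, hδ]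
      push_cast
      congr 1 <;> ring
    have hdiag : (2 * (m : ℚ) + n - i - i) / ((n : ℚ) - i - i) =
        ((ℓ : ℚ) - i + m) / ((ℓ : ℚ) - i) := by
      rw [hn, ← mul_div_mul_left ((ℓ : ℚ) - i + m) ((ℓ : ℚ) - i) two_ne_zero]
      push_cast
      congr 1 <;> ring
    rw [hsplit, hlow, hhigh,
      prod_Icc_mul_reflect (fun j : ℕ => ((j : ℚ) - i + m) / ((j : ℚ) - i)) hbℓ, ← hn,
      ← Finset.mul_prod_Ioc_eq_prod_Icc hib, ← Finset.Icc_add_one_left_eq_Ioc, hdiag]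
    ring
  · intro i hi hib
    rw [Finset.mem_Icc] at hi hib
    refine Finset.prod_eq_one fun j hj => ?_
    rw [Finset.mem_Icc] at hj
    rw [hlam, hlam, if_neg (by omega), if_neg (by omega), zero_add, zero_add]
    exact div_self (hδne i j hi.1 (by omega) hj.2)
end
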